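/- arXiv:0908.0477 — 7 statements merged into one kernel-verified Lean document; each statement's English description precedes it below -/
import Mathlib

section
/- Every odometer can be embedded in a gliders-with-reflecting-walls cellular automaton. Precisely: for every sequence S = (s_1, s_2, …) of integers each ≥ 2 there exists k ∈ {1,2} such that the S-adic odometer (Z̃(S), +1̃) can be embedded in (X_glider, T̃^k), where T̃ is the gliders-with-reflecting-walls cellular automaton map. -/
instance (n : ℕ) : TopologicalSpace (ZMod n) := ⊥
instance (n : ℕ) : DiscreteTopology (ZMod n) := ⟨rfl⟩

/-- `odProd S k = s₁ s₂ ⋯ s_{k+1}` (where `S i = s_{i+1}`, i.e. `S 0 = s₁`). -/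
def odProd (S : ℕ → ℕ) (k : ℕ) : ℕ := ∏ i ∈ Finset.range (k + 1), S i

theorem odProd_dvd (S : ℕ → ℕ) (k : ℕ) : odProd S k ∣ odProd S (k + 1) := by
  have h : odProd S (k + 1) = odProd S k * S (k + 1) := Finset.prod_range_succ S (k + 1)
  rw [h]
  exact dvd_mul_right _ _

/-- `Z̃(S)`: the inverse limit of the cyclic groups `ℤ/(s₁⋯s_k)ℤ` under the
binding maps `z ↦ z mod s₁⋯s_k`, with its profinite (subspace-of-product)
topology. -/
def OdometerSpace (S : ℕ → ℕ) : Type :=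
  { z : (k : ℕ) → ZMod (odProd S k) //
      ∀ k, ZMod.castHom (odProd_dvd S k) (ZMod (odProd S k)) (z (k + 1)) = z k }

instance (S : ℕ → ℕ) : TopologicalSpace (OdometerSpace S) :=
  inferInstanceAs (TopologicalSpace
    { z : (k : ℕ) → ZMod (odProd S k) //
        ∀ k, ZMod.castHom (odProd_dvd S k) (ZMod (odProd S k)) (z (k + 1)) = z k })

/-- The `+1̃` map on the odometer: add `1` in every coordinate. -/
def odometerAddOne (S : ℕ → ℕ) (z : OdometerSpace S) : OdometerSpace S :=
  ⟨fun k => z.1 k + 1, fun k => by rw [map_add, map_one, z.2 k]⟩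

/-- The alphabet `{W, L, R, ∅}` of the gliders-with-reflecting-walls CA
(`E` denotes the empty cell `∅`). -/
inductive GSym : Type
  | W : GSym
  | L : GSym
  | R : GSym
  | E : GSym
  deriving DecidableEq

instance : TopologicalSpace GSym := ⊥
instance : DiscreteTopology GSym := ⟨rfl⟩

/-- The gliders-with-reflecting-walls map `T̃` (cells indexed by ℕ, cell 0
being the leftmost cell): walls do not move; an `L` with `∅` immediately to
its left swaps places with it, and an `L` with `W` immediately to its left
becomes `R` without moving; an `R` with `∅` immediately to its right swaps
places with it, and an `R` with `W` immediately to its right becomes `L`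
without moving. -/
def gliderStep (x : ℕ → GSym) : ℕ → GSym := fun i =>
  match x i with
  | GSym.W => GSym.W
  | GSym.L => if x (i - 1) = GSym.W then GSym.R else GSym.E
  | GSym.R => if x (i + 1) = GSym.W then GSym.L else GSym.E
  | GSym.E =>
      if x (i + 1) = GSym.L then GSym.L
      else if x (i - 1) = GSym.R then GSym.R
      else GSym.E

/-- The glider state space `X_glider`: the first cell is a wall, there are
infinitely many walls, and strictly between any two consecutive walls there is
exactly one particle (`L` or `R`), all other cells there being empty. -/
def XGlider : Set (ℕ → GSym) :=
  { x | x 0 = GSym.W ∧ (∀ N : ℕ, ∃ i, N ≤ i ∧ x i = GSym.W) ∧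
      ∀ i j : ℕ, i < j → x i = GSym.W → x j = GSym.W →
        (∀ k, i < k → k < j → x k ≠ GSym.W) →
        ∃! k, i < k ∧ k < j ∧ (x k = GSym.L ∨ x k = GSym.R) }

/-- The content of cell `d` (counted from the left wall) of a gap of `n` cells closed by walls at
`0` and `n + 1`, when the glider has phase `f < 2 * n`: it moves right for `f < n`, then left. -/
def gapCell (n f d : ℕ) : GSym :=
  if d = 0 ∨ d = n + 1 then GSym.W
  else if d = f + 1 then GSym.R
  else if d + f = 2 * n then GSym.L
  else GSym.E

theorem gapCell_eq_W_iff {n f d : ℕ} : gapCell n f d = GSym.W ↔ d = 0 ∨ d = n + 1 := by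
  unfold gapCell
  split_ifs <;> simp_all

theorem gapCell_eq_R_iff {n f d : ℕ} (h0 : 0 < d) (hd : d ≤ n) :
    gapCell n f d = GSym.R ↔ d = f + 1 := by
  have h : ¬ (d = 0 ∨ d = n + 1) := by omega
  unfold gapCell
  rw [if_neg h]
  split_ifs <;> simp_all

theorem gapCell_eq_L_iff {n f d : ℕ} (h0 : 0 < d) (hd : d ≤ n) :
    gapCell n f d = GSym.L ↔ d + f = 2 * n := by
  have h : ¬ (d = 0 ∨ d = n + 1) := by omega
  unfold gapCell
  rw [if_neg h]
  split_ifs <;> simp <;> omega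

theorem gapCell_zero (n f : ℕ) : gapCell n f 0 = GSym.W := gapCell_eq_W_iff.2 (Or.inl rfl)

theorem gapCell_succ_self (n f : ℕ) : gapCell n f (n + 1) = GSym.W :=
  gapCell_eq_W_iff.2 (Or.inr rfl)

/-- The gap and the offset inside it of each cell, for gaps of lengths `n 0, n 1, …`. -/
def gapLoc (n : ℕ → ℕ) : ℕ → ℕ × ℕ
  | 0 => (0, 0)
  | i + 1 =>
    if (gapLoc n i).2 = n (gapLoc n i).1 then ((gapLoc n i).1 + 1, 0)
    else ((gapLoc n i).1, (gapLoc n i).2 + 1)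

/-- The position of the `k`-th wall for gaps of lengths `n 0, n 1, …`. -/
def wallPos (n : ℕ → ℕ) : ℕ → ℕ
  | 0 => 0
  | k + 1 => wallPos n k + n k + 1

theorem le_wallPos (n : ℕ → ℕ) (k : ℕ) : k ≤ wallPos n k := by
  induction k with
  | zero => exact Nat.zero_le _
  | succ k ih => simp only [wallPos]; omega

theorem gapLoc_wallPos_add_of (n : ℕ → ℕ) (k : ℕ) (h : gapLoc n (wallPos n k) = (k, 0)) :
    ∀ d ≤ n k, gapLoc n (wallPos n k + d) = (k, d) := by
  intro d
  induction d with
  | zero => intro _; simpa using h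
  | succ d ih =>
    intro hd
    rw [← add_assoc, gapLoc, ih (by omega)]
    simp only
    rw [if_neg (by omega)]

theorem gapLoc_wallPos (n : ℕ → ℕ) (k : ℕ) : gapLoc n (wallPos n k) = (k, 0) := by
  induction k with
  | zero => rfl
  | succ k ih =>
    rw [wallPos, gapLoc, gapLoc_wallPos_add_of n k ih _ le_rfl]
    simp

theorem gapLoc_wallPos_add (n : ℕ → ℕ) {k d : ℕ} (hd : d ≤ n k) :
    gapLoc n (wallPos n k + d) = (k, d) :=
  gapLoc_wallPos_add_of n k (gapLoc_wallPos n k) d hd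

theorem exists_eq_wallPos_add (n : ℕ → ℕ) (i : ℕ) :
    ∃ k d, d ≤ n k ∧ i = wallPos n k + d := by
  induction i with
  | zero => exact ⟨0, 0, Nat.zero_le _, rfl⟩
  | succ i ih =>
    obtain ⟨k, d, hd, rfl⟩ := ih
    rcases hd.eq_or_lt with rfl | hlt
    · exact ⟨k + 1, 0, Nat.zero_le _, rfl⟩
    · exact ⟨k, d + 1, hlt, rfl⟩

/-- The glider configuration with gap lengths `n` and glider phases `f`. -/
def gliderConfig (n f : ℕ → ℕ) (i : ℕ) : GSym :=
  gapCell (n (gapLoc n i).1) (f (gapLoc n i).1) (gapLoc n i).2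

theorem gliderConfig_wallPos_add (n f : ℕ → ℕ) {k d : ℕ} (hd : d ≤ n k + 1) :
    gliderConfig n f (wallPos n k + d) = gapCell (n k) (f k) d := by
  rcases hd.eq_or_lt with rfl | hlt
  · rw [gapCell_succ_self, ← add_assoc, ← wallPos, gliderConfig, gapLoc_wallPos, gapCell_zero]
  · rw [gliderConfig, gapLoc_wallPos_add n (Nat.lt_succ_iff.1 hlt)]

theorem gliderConfig_wallPos (n f : ℕ → ℕ) (k : ℕ) : gliderConfig n f (wallPos n k) = GSym.W := by
  simpa [gapCell_zero] using gliderConfig_wallPos_add n f (k := k) (d := 0) (Nat.zero_le _)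

theorem exists_eq_wallPos_of_gliderConfig_eq_W {n f : ℕ → ℕ} {i : ℕ}
    (h : gliderConfig n f i = GSym.W) : ∃ k, i = wallPos n k := by
  obtain ⟨k, d, hd, rfl⟩ := exists_eq_wallPos_add n i
  rw [gliderConfig_wallPos_add n f (by omega), gapCell_eq_W_iff] at h
  exact ⟨k, by omega⟩

theorem gliderStep_gliderConfig (n f : ℕ → ℕ) (hf : ∀ k, f k < 2 * n k) :
    gliderStep (gliderConfig n f) = gliderConfig n (fun k => (f k + 1) % (2 * n k)) := by
  funext i
  obtain ⟨k, d, hd, rfl⟩ := exists_eq_wallPos_add n i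
  have hfk := hf k
  rcases d with _ | d
  · simp only [gliderStep, add_zero, gliderConfig_wallPos]
  · have hmod : f k + 1 = 2 * n k ∧ (f k + 1) % (2 * n k) = 0 ∨
        f k + 1 < 2 * n k ∧ (f k + 1) % (2 * n k) = f k + 1 := by
      rcases (Nat.succ_le_of_lt hfk).eq_or_lt with h | h
      · exact Or.inl ⟨h, by rw [← h, Nat.succ_eq_add_one, Nat.mod_self]⟩
      · exact Or.inr ⟨h, Nat.mod_eq_of_lt h⟩
    have hp : wallPos n k + (d + 1) - 1 = wallPos n k + d := by omega
    have hs : wallPos n k + (d + 1) + 1 = wallPos n k + (d + 2) := by omega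
    simp only [gliderStep, hp, hs]
    rw [gliderConfig_wallPos_add n f (by omega), gliderConfig_wallPos_add n f (by omega),
      gliderConfig_wallPos_add n f (by omega), gliderConfig_wallPos_add n _ (by omega)]
    generalize (f k + 1) % (2 * n k) = b at *
    generalize f k = a at *
    generalize n k = m at *
    clear hp hs hf
    unfold gapCell
    rcases hmod with ⟨ha, rfl⟩ | ⟨ha, rfl⟩ <;> grind (splits := 20)

theorem iterate_gliderStep_gliderConfig (n f : ℕ → ℕ) (hf : ∀ k, f k < 2 * n k) (c : ℕ) :
    gliderStep^[c] (gliderConfig n f) = gliderConfig n (fun k => (f k + c) % (2 * n k)) := by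
  induction c with
  | zero => simp [Nat.mod_eq_of_lt (hf _)]
  | succ c ih =>
    rw [Function.iterate_succ_apply', ih, gliderStep_gliderConfig]
    · simp only [Nat.mod_add_mod, add_assoc]
    · exact fun k => Nat.mod_lt _ (by have := hf k; omega)

theorem gliderConfig_mem_XGlider (n f : ℕ → ℕ) (hf : ∀ k, f k < 2 * n k) :
    gliderConfig n f ∈ XGlider := by
  refine ⟨gliderConfig_wallPos n f 0, fun N => ⟨_, le_wallPos n N, gliderConfig_wallPos n f N⟩, ?_⟩
  intro i j hij hi hj hbetween
  obtain ⟨k, rfl⟩ := exists_eq_wallPos_of_gliderConfig_eq_W hi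
  have hfk := hf k
  have hnext : wallPos n (k + 1) = wallPos n k + n k + 1 := rfl
  obtain rfl : j = wallPos n (k + 1) := by
    rcases lt_trichotomy j (wallPos n (k + 1)) with h | h | h
    · obtain ⟨d, rfl⟩ := Nat.exists_eq_add_of_lt hij
      rw [add_assoc, gliderConfig_wallPos_add n f (by omega), gapCell_eq_W_iff] at hj
      omega
    · exact h
    · exact absurd (gliderConfig_wallPos n f (k + 1)) (hbetween _ (by omega) h)
  have key : ∀ d, 0 < d → d ≤ n k →
      ((gliderConfig n f (wallPos n k + d) = GSym.L ∨ gliderConfig n f (wallPos n k + d) = GSym.R) ↔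
        (d + f k = 2 * n k ∨ d = f k + 1)) := by
    intro d h0 hd
    rw [gliderConfig_wallPos_add n f (by omega), gapCell_eq_L_iff h0 hd, gapCell_eq_R_iff h0 hd]
  obtain ⟨d, h0, hd, hdf⟩ : ∃ d, 0 < d ∧ d ≤ n k ∧ (d + f k = 2 * n k ∨ d = f k + 1) := by
    by_cases h : f k < n k
    · exact ⟨f k + 1, by omega, by omega, Or.inr rfl⟩
    · exact ⟨2 * n k - f k, by omega, by omega, Or.inl (by omega)⟩
  refine ⟨wallPos n k + d, ⟨by omega, by omega, (key d h0 hd).2 hdf⟩, ?_⟩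
  rintro m ⟨h1, h2, h3⟩
  obtain ⟨e, rfl⟩ := Nat.exists_eq_add_of_le h1.le
  have := (key e (by omega) (by omega)).1 h3
  omega

theorem gliderConfig_injOn (n : ℕ → ℕ) :
    Set.InjOn (gliderConfig n) {f | ∀ k, f k < 2 * n k} := by
  intro f hf g hg h
  funext k
  have hfk : f k < 2 * n k := hf k
  have hgk : g k < 2 * n k := hg k
  have hcell : ∀ d ≤ n k, gapCell (n k) (f k) d = gapCell (n k) (g k) d := by
    intro d hd
    rw [← gliderConfig_wallPos_add n f (by omega), ← gliderConfig_wallPos_add n g (by omega), h]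
  by_cases hlt : f k < n k
  · have := hcell (f k + 1) hlt
    rw [(gapCell_eq_R_iff (by omega) hlt).2 rfl, eq_comm, gapCell_eq_R_iff (by omega) hlt] at this
    omega
  · have hd : 2 * n k - f k ≤ n k := by omega
    have := hcell _ hd
    rw [(gapCell_eq_L_iff (by omega) hd).2 (by omega), eq_comm,
      gapCell_eq_L_iff (by omega) hd] at this
    omega

theorem odProd_pos {S : ℕ → ℕ} (hS : ∀ k, 2 ≤ S k) (k : ℕ) : 0 < odProd S k :=
  Finset.prod_pos fun i _ => by have := hS i; omega

theorem compactSpace_odometerSpace {S : ℕ → ℕ} (hS : ∀ k, 2 ≤ S k) :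
    CompactSpace (OdometerSpace S) := by
  have : ∀ k, NeZero (odProd S k) := fun k => ⟨(odProd_pos hS k).ne'⟩
  have hclosed : IsClosed {z : (k : ℕ) → ZMod (odProd S k) |
      ∀ k, ZMod.castHom (odProd_dvd S k) (ZMod (odProd S k)) (z (k + 1)) = z k} := by
    rw [Set.ofPred_forall]
    exact isClosed_iInter fun k => isClosed_eq
      (continuous_of_discreteTopology.comp (continuous_apply (k + 1))) (continuous_apply k)
  exact isCompact_iff_compactSpace.1 hclosed.isCompact

theorem continuous_odometerSpace_coord (S : ℕ → ℕ) (k : ℕ) :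
    Continuous fun z : OdometerSpace S => z.1 k :=
  (continuous_apply k).comp continuous_subtype_val

theorem OdometerSpace.ext_of_tail {S : ℕ → ℕ} {z w : OdometerSpace S} (K : ℕ)
    (h : ∀ k, z.1 (K + k) = w.1 (K + k)) : z = w := by
  have hback : ∀ m k, z.1 (k + m) = w.1 (k + m) → z.1 k = w.1 k := by
    intro m
    induction m with
    | zero => exact fun k hk => hk
    | succ m ih =>
      intro k hk
      refine ih k ?_
      rw [← z.2 (k + m), ← w.2 (k + m)]
      exact congrArg _ hk
  exact Subtype.ext (funext fun k => hback K k (by rw [add_comm]; exact h k))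

/-- If the gaps satisfy `2 * n k = c * (s₁ ⋯ s_{K+k+1})`, then the odometer embeds in the `c`-th
power of the glider map, through configurations with gap lengths `n`. -/
theorem odometer_embeds_of_gaps {S : ℕ → ℕ} (hS : ∀ k, 2 ≤ S k) {c K : ℕ} (hc : 0 < c)
    (n : ℕ → ℕ) (hn : ∀ k, 2 * n k = c * odProd S (K + k)) :
    ∃ Y : Set (ℕ → GSym), Y ⊆ XGlider ∧ IsClosed Y ∧
      Set.MapsTo (gliderStep^[c]) Y Y ∧
      ∃ h : OdometerSpace S ≃ₜ Y,
        ∀ z, (h (odometerAddOne S z) : ℕ → GSym) = gliderStep^[c] (h z) := by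
  have : ∀ k, NeZero (odProd S k) := fun k => ⟨(odProd_pos hS k).ne'⟩
  have := compactSpace_odometerSpace hS
  let phase (z : OdometerSpace S) (k : ℕ) : ℕ := c * (z.1 (K + k)).val
  have hphase : ∀ z k, phase z k < 2 * n k := fun z k => by
    rw [hn]
    exact Nat.mul_lt_mul_of_pos_left (ZMod.val_lt _) hc
  let F (z : OdometerSpace S) : ℕ → GSym := gliderConfig n (phase z)
  have hcont : Continuous F := continuous_pi fun i =>
    (continuous_of_discreteTopology (f := fun a : ZMod (odProd S (K + (gapLoc n i).1)) =>
      gapCell (n (gapLoc n i).1) (c * a.val) (gapLoc n i).2)).comp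
      (continuous_odometerSpace_coord S (K + (gapLoc n i).1))
  have hinj : Function.Injective F := fun z w h => by
    have hzw := gliderConfig_injOn n (hphase z) (hphase w) h
    exact OdometerSpace.ext_of_tail K fun k =>
      ZMod.val_injective _ (Nat.eq_of_mul_eq_mul_left hc (congrFun hzw k))
  have hstep : ∀ z, F (odometerAddOne S z) = gliderStep^[c] (F z) := fun z => by
    simp only [F]
    rw [iterate_gliderStep_gliderConfig n _ (hphase z)]
    congr 1
    funext k
    simp only [phase, odometerAddOne]
    rw [hn, ← Nat.mul_succ, Nat.mul_mod_mul_left, ZMod.val_add, ZMod.val_one_eq_one_mod,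
      Nat.add_mod_mod]
  have hemb := hcont.isClosedEmbedding hinj
  refine ⟨Set.range F, ?_, hemb.isClosed_range, ?_, hemb.toIsEmbedding.toHomeomorph, hstep⟩
  · rintro _ ⟨z, rfl⟩
    exact gliderConfig_mem_XGlider n _ (hphase z)
  · rintro _ ⟨z, rfl⟩
    exact ⟨odometerAddOne S z, hstep z⟩

/-- Every odometer can be embedded in a gliders-with-reflecting-walls cellular
automaton: for every sequence `S` of integers `≥ 2` there is `k ∈ {1, 2}` such
that the `S`-adic odometer embeds in `(X_glider, T̃^k)`. -/
theorem odometer_embeds_in_glider (S : ℕ → ℕ) (hS : ∀ k, 2 ≤ S k) :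
    ∃ k : ℕ, (k = 1 ∨ k = 2) ∧
      ∃ Y : Set (ℕ → GSym), Y ⊆ XGlider ∧ IsClosed Y ∧
        Set.MapsTo (gliderStep^[k]) Y Y ∧
        ∃ h : OdometerSpace S ≃ₜ Y,
          ∀ z, (h (odometerAddOne S z) : ℕ → GSym) = gliderStep^[k] (h z) := by
  by_cases heven : ∃ K, 2 ∣ S K
  · obtain ⟨K, hK⟩ := heven
    refine ⟨1, Or.inl rfl,
      odometer_embeds_of_gaps hS (K := K) one_pos (fun k => odProd S (K + k) / 2) fun k => ?_⟩
    rw [one_mul]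
    exact Nat.mul_div_cancel' (hK.trans (Finset.dvd_prod_of_mem S (by simp)))
  · exact ⟨2, Or.inr rfl,
      odometer_embeds_of_gaps hS (K := 0) two_pos (odProd S) fun k => by rw [zero_add]⟩
end

section
/- Let S = (s_1, s_2, …) be a sequence of integers each ≥ 2 such that the set of prime divisors of the members of S is finite, and let n be the product of the primes that divide infinitely many members of S (this set of primes is nonempty, so n ≥ 2). Then the S-adic odometer (Z̃(S), +1̃) can be embedded in the two-sided cellular automaton ((ℤ/nℤ)^ℤ, T_n). -/
/-- The two-sided cellular automaton `T_n` on `(ℤ/nℤ)^ℤ` with local rule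
`xᵢ ↦ xᵢ + xᵢ₊₁ (mod n)`. -/
def Tca (n : ℕ) (x : ℤ → ZMod n) : ℤ → ZMod n := fun i => x i + x (i + 1)

theorem cast_choose_periodic (n k a c : ℕ) :
    ((a + n ^ k * c).choose k : ZMod n) = (a.choose k : ZMod n) := by
  induction k generalizing a c with
  | zero => simp
  | succ k ih =>
    have hstep : ∀ a, ((a + n ^ k).choose (k + 1) : ZMod n) =
        a.choose (k + 1) + (n ^ k).choose (k + 1) := by
      intro a
      induction a with
      | zero => simp
      | succ a iha =>
        have h := ih a 1
        rw [mul_one] at h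
        rw [Nat.add_right_comm, Nat.choose_succ_succ' (a + n ^ k), Nat.choose_succ_succ' a]
        push_cast
        rw [iha, h]
        ring
    have hmul : ∀ c a, ((a + n ^ k * c).choose (k + 1) : ZMod n) =
        a.choose (k + 1) + c * (n ^ k).choose (k + 1) := by
      intro c
      induction c with
      | zero => simp
      | succ c ihc =>
        intro a
        rw [mul_add, mul_one, ← add_assoc, hstep, ihc]
        push_cast
        ring
    rw [pow_succ, mul_assoc, hmul]
    simp

theorem cast_choose_eq_of_modEq {n k a b : ℕ} (h : a ≡ b [MOD n ^ k]) :
    (a.choose k : ZMod n) = (b.choose k : ZMod n) := by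
  wlog hab : a ≤ b generalizing a b
  · exact (this h.symm (le_of_not_ge hab)).symm
  obtain ⟨c, hc⟩ := (Nat.modEq_iff_dvd' hab).1 h
  obtain rfl : b = a + n ^ k * c := by omega
  exact (cast_choose_periodic n k a c).symm

theorem modEq_pow_of_choose_modEq {p : ℕ} [Fact p.Prime] (j : ℕ) {a b : ℕ}
    (h : ∀ i ≤ p ^ j, a.choose i ≡ b.choose i [MOD p]) : a ≡ b [MOD p ^ j] := by
  induction j generalizing a b with
  | zero => simpa using Nat.modEq_one
  | succ j ih =>
    have hp : 0 < p := (Fact.out : p.Prime).pos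
    have h0 : a ≡ b [MOD p] := by
      simpa using h 1 (Nat.one_le_pow _ _ hp)
    have hdiv (a i : ℕ) : a.choose (p * i) ≡ (a / p).choose i [MOD p] := by
      have := Choose.choose_modEq_choose_mod_mul_choose_div_nat (n := a) (k := p * i) (p := p)
      simpa [hp] using this
    have h1 : a / p ≡ b / p [MOD p ^ j] := ih fun i hi =>
      (hdiv a i).symm.trans ((h _ (by rw [pow_succ']; exact Nat.mul_le_mul_left p hi)).trans
        (hdiv b i))
    rw [← Nat.mod_add_div a p, ← Nat.mod_add_div b p, show a % p = b % p from h0, pow_succ']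
    exact (h1.mul_left' p).add_left _

theorem exists_coprime_mul_dvd_pow (n : ℕ) {N : ℕ} (hN : N ≠ 0) :
    ∃ m r j, N = m * r ∧ m.Coprime n ∧ r ∣ n ^ j := by
  induction N using Nat.strong_induction_on with
  | _ N ih =>
    by_cases hc : N.Coprime n
    · exact ⟨N, 1, 0, by simp, hc, by simp⟩
    · obtain ⟨M, hM⟩ := Nat.gcd_dvd_left N n
      have hM0 : M ≠ 0 := by rintro rfl; simp at hM; exact hN hM
      have hg : 1 < N.gcd n := by
        have : N.gcd n ≠ 0 := fun h => hN (Nat.eq_zero_of_gcd_eq_zero_left h)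
        have : N.gcd n ≠ 1 := hc
        omega
      obtain ⟨m, r, j, rfl, hm, hr⟩ := ih M (by nlinarith [Nat.pos_of_ne_zero hM0]) hM0
      refine ⟨m, N.gcd n * r, j + 1, ?_, hm, ?_⟩
      · rw [mul_left_comm]; exact hM
      · rw [pow_succ']; exact mul_dvd_mul (Nat.gcd_dvd_right N n) hr

theorem exists_periodic_orbit (p : ℕ) [Fact p.Prime] {m : ℕ} (hm : m.Coprime p) :
    ∃ y : ℕ → ℤ → ZMod p, (∀ a, Tca p (y a) = y (a + 1)) ∧
      (∀ a b, a ≡ b [MOD m] → y a = y b) ∧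
      ∀ a b, (∀ i, 0 < i → y a i = y b i) → a ≡ b [MOD m] := by
  rcases eq_or_ne m 1 with rfl | hm1
  · exact ⟨fun _ _ => 0, fun a => by ext; simp [Tca], fun _ _ _ => rfl,
      fun a b _ => Nat.modEq_one⟩
  have hmp : ¬ p ∣ m := fun h =>
    (Fact.out : p.Prime).one_lt.ne' (Nat.eq_one_of_dvd_coprimes hm h dvd_rfl)
  have : NeZero (m : ZMod p) := ⟨fun h => hmp ((ZMod.natCast_eq_zero_iff _ _).1 h)⟩
  have : NeZero m := NeZero.of_neZero_natCast (ZMod p)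
  let K := CyclotomicField m (ZMod p)
  have : NeZero (m : K) := NeZero.nat_of_injective (algebraMap (ZMod p) K).injective
  let α : K := IsCyclotomicExtension.zeta m (ZMod p) K
  have hα : IsPrimitiveRoot α m := IsCyclotomicExtension.zeta_spec m (ZMod p) K
  have hα1 : α - 1 ≠ 0 := sub_ne_zero.2 (hα.ne_one (by have := NeZero.ne m; omega))
  have hspan : ∀ x : K, ∃ f : Polynomial (ZMod p), Polynomial.aeval (α - 1) f = x := by
    intro x
    have htop := IsCyclotomicExtension.adjoin_primitive_root_eq_top (A := ZMod p) hα
    have hx : x ∈ Algebra.adjoin (ZMod p) {α} := htop ▸ Algebra.mem_top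
    rw [Algebra.adjoin_singleton_eq_range_aeval] at hx
    obtain ⟨f, rfl⟩ := hx
    exact ⟨f.comp (Polynomial.X + 1), by simp [Polynomial.aeval_comp]⟩
  have : FiniteDimensional (ZMod p) K :=
    IsCyclotomicExtension.finiteDimensional {m} (ZMod p) K
  let l : K →ₗ[ZMod p] ZMod p := Algebra.trace (ZMod p) K
  have hl : l ≠ 0 := Algebra.trace_ne_zero (ZMod p) K
  refine ⟨fun a i => l (α ^ a * (α - 1) ^ i), fun a => ?_, fun a b hab => ?_, fun a b hab => ?_⟩
  · ext i
    simp only [Tca]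
    rw [← map_add, zpow_add_one₀ hα1]
    congr 1
    ring
  · ext i
    have : α ^ a = α ^ b := (hα.isOfFinOrder (NeZero.ne m)).pow_eq_pow_iff_modEq.2 (hα.eq_orderOf ▸ hab)
    simp only [this]
  · by_contra hne
    have hβ : α ^ a - α ^ b ≠ 0 := fun h => hne (by
      rw [hα.eq_orderOf]
      exact (hα.isOfFinOrder (NeZero.ne m)).pow_eq_pow_iff_modEq.1 (sub_eq_zero.1 h))
    have hzero : ∀ f : Polynomial (ZMod p),
        l ((α ^ a - α ^ b) * (α - 1) * Polynomial.aeval (α - 1) f) = 0 := by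
      intro f
      induction f using Polynomial.induction_on' with
      | add f g hf hg => rw [map_add, mul_add, map_add, hf, hg, add_zero]
      | monomial k c =>
        have h := hab (k + 1) (by positivity)
        rw [← sub_eq_zero, ← map_sub] at h
        rw [Polynomial.aeval_monomial, ← Algebra.smul_def, mul_smul_comm, map_smul]
        convert smul_zero c
        rw [← h]
        congr 1
        rw [zpow_add_one₀ hα1, zpow_natCast]
        ring
    refine hl (LinearMap.ext fun x => ?_)
    obtain ⟨f, hf⟩ := hspan (((α ^ a - α ^ b) * (α - 1))⁻¹ * x)
    have := hzero f
    rwa [hf, mul_inv_cancel_left₀ (mul_ne_zero hβ hα1)] at this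

theorem odProd_dvd_of_le (S : ℕ → ℕ) {k l : ℕ} (h : k ≤ l) : odProd S k ∣ odProd S l := by
  induction l, h using Nat.le_induction with
  | base => exact dvd_rfl
  | succ l _ ih => exact ih.trans (odProd_dvd S l)

/-- A prime dividing infinitely many terms occurs to every power in the partial products. -/
theorem exists_pow_dvd_odProd {S : ℕ → ℕ} {p : ℕ} (hp : {k : ℕ | p ∣ S k}.Infinite) (j : ℕ) :
    ∃ k, p ^ j ∣ odProd S k := by
  induction j with
  | zero => exact ⟨0, by simp⟩
  | succ j ih =>
    obtain ⟨k, hk⟩ := ih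
    obtain ⟨l, hl, hkl⟩ := hp.exists_gt k
    obtain ⟨l, rfl⟩ : ∃ l', l = l' + 1 := ⟨l - 1, by omega⟩
    refine ⟨l + 1, ?_⟩
    have h : odProd S (l + 1) = odProd S l * S (l + 1) := Finset.prod_range_succ S (l + 1)
    rw [h, pow_succ]
    exact mul_dvd_mul (hk.trans (odProd_dvd_of_le S (by omega))) hl

theorem prod_pow_dvd {P : Finset ℕ} (hP : ∀ p ∈ P, p.Prime) {j N : ℕ}
    (h : ∀ p ∈ P, p ^ j ∣ N) : (∏ p ∈ P, p) ^ j ∣ N := by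
  rw [← Finset.prod_pow]
  refine Finset.prod_dvd_of_isRelPrime (fun p hp q hq hpq => ?_) h
  exact Nat.coprime_iff_isRelPrime.1
    (Nat.Coprime.pow _ _ ((Nat.coprime_primes (hP p hp) (hP q hq)).2 hpq))

namespace OdometerSpace

variable {S : ℕ → ℕ}

theorem castHom_apply (z : OdometerSpace S) {k l : ℕ} (h : k ≤ l) :
    ZMod.castHom (odProd_dvd_of_le S h) (ZMod (odProd S k)) (z.1 l) = z.1 k := by
  induction l, h using Nat.le_induction with
  | base => simp
  | succ l hl ih =>
    rw [← ih, ← z.2 l]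
    exact (RingHom.congr_fun (ZMod.castHom_comp (odProd_dvd_of_le S hl) (odProd_dvd S l)) _).symm

theorem val_modEq (hS : ∀ k, 2 ≤ S k) (z : OdometerSpace S) {k l : ℕ} (h : k ≤ l) :
    (z.1 l).val ≡ (z.1 k).val [MOD odProd S k] := by
  have : ∀ k, NeZero (odProd S k) := fun k => ⟨(odProd_pos hS k).ne'⟩
  rw [← ZMod.natCast_eq_natCast_iff, ZMod.natCast_zmod_val, ← z.castHom_apply h,
    ZMod.castHom_apply, ZMod.natCast_val]

theorem compactSpace (hS : ∀ k, 2 ≤ S k) : CompactSpace (OdometerSpace S) := by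
  have : ∀ k, NeZero (odProd S k) := fun k => ⟨(odProd_pos hS k).ne'⟩
  have hclosed : IsClosed {z : (k : ℕ) → ZMod (odProd S k) |
      ∀ k, ZMod.castHom (odProd_dvd S k) (ZMod (odProd S k)) (z (k + 1)) = z k} := by
    rw [Set.ofPred_forall]
    exact isClosed_iInter fun k => isClosed_eq
      (continuous_of_discreteTopology.comp (continuous_apply (k + 1))) (continuous_apply k)
  exact isCompact_iff_compactSpace.1 hclosed.isCompact

/-- An orbit `F` of `Tca n` whose coordinates are periodic with periods dividing the partial
products of `S`, and which separates residues modulo each partial product on finite windows,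
extends to an embedding of the odometer. -/
theorem exists_embedding_of_orbit (hS : ∀ k, 2 ≤ S k) {n : ℕ} (F : ℕ → ℤ → ZMod n)
    (hF : ∀ a, Tca n (F a) = F (a + 1))
    (hper : ∀ i, ∃ k, ∀ a b, a ≡ b [MOD odProd S k] → F a i = F b i)
    (hsep : ∀ k, ∃ W : Finset ℤ, ∀ a b, (∀ i ∈ W, F a i = F b i) → a ≡ b [MOD odProd S k]) :
    ∃ Y : Set (ℤ → ZMod n), IsClosed Y ∧ Set.MapsTo (Tca n) Y Y ∧
      ∃ h : OdometerSpace S ≃ₜ Y,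
        ∀ z, (h (odometerAddOne S z) : ℤ → ZMod n) = Tca n (h z) := by
  have : ∀ k, NeZero (odProd S k) := fun k => ⟨(odProd_pos hS k).ne'⟩
  have := compactSpace hS
  choose κ hκ using hper
  let φ : OdometerSpace S → ℤ → ZMod n := fun z i => F (z.1 (κ i)).val i
  have hφ (z : OdometerSpace S) {i : ℤ} {k : ℕ} (h : κ i ≤ k) : φ z i = F (z.1 k).val i :=
    hκ i _ _ (z.val_modEq hS h).symm
  have hcont : Continuous φ := continuous_pi fun i =>
    (continuous_of_discreteTopology (f := fun x : ZMod (odProd S (κ i)) => F x.val i)).comp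
      ((continuous_apply (κ i)).comp continuous_subtype_val)
  have hinj : Function.Injective φ := by
    refine fun z w hzw => Subtype.ext (funext fun k => ?_)
    obtain ⟨W, hW⟩ := hsep k
    let K := max k (W.sup κ)
    have h := hW (z.1 K).val (w.1 K).val fun i hi => by
      have hi : κ i ≤ K := (Finset.le_sup hi).trans (le_max_right _ _)
      rw [← hφ z hi, ← hφ w hi, hzw]
    have h' := ((z.val_modEq hS (le_max_left k _)).symm.trans h).trans
      (w.val_modEq hS (le_max_left k _))
    rwa [← ZMod.natCast_eq_natCast_iff, ZMod.natCast_zmod_val, ZMod.natCast_zmod_val] at h'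
  have hequi (z : OdometerSpace S) : φ (odometerAddOne S z) = Tca n (φ z) := by
    ext i
    let K := max (κ i) (κ (i + 1))
    have hadd : ((z.1 (κ i) + 1 : ZMod (odProd S (κ i)))).val ≡ (z.1 K).val + 1
        [MOD odProd S (κ i)] := by
      refine Nat.ModEq.trans ?_ ((z.val_modEq hS (le_max_left _ _)).symm.add_right 1)
      rw [← ZMod.natCast_eq_natCast_iff]
      simp
    calc φ (odometerAddOne S z) i = F ((z.1 K).val + 1) i := hκ i _ _ hadd
      _ = F (z.1 K).val i + F (z.1 K).val (i + 1) := by rw [← hF]; rfl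
      _ = Tca n (φ z) i := by
        rw [← hφ z (le_max_left _ _), ← hφ z (le_max_right _ _)]; rfl
  have hemb := hcont.isClosedEmbedding hinj
  refine ⟨Set.range φ, hemb.isClosed_range, ?_, hemb.isEmbedding.toHomeomorph, hequi⟩
  rintro _ ⟨z, rfl⟩
  exact ⟨_, hequi z⟩

end OdometerSpace

/-- The orbit of the sequence supported at `0`, along the rows of Pascal's triangle. -/
def pascalOrbit (n a : ℕ) (i : ℤ) : ZMod n := if i ≤ 0 then (a.choose (-i).toNat : ZMod n) else 0

theorem Tca_pascalOrbit (n a : ℕ) : Tca n (pascalOrbit n a) = pascalOrbit n (a + 1) := by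
  ext i
  simp only [Tca, pascalOrbit]
  rcases lt_trichotomy i 0 with hi | rfl | hi
  · obtain ⟨k, rfl⟩ : ∃ k : ℕ, i = -((k : ℤ) + 1) := ⟨(-i - 1).toNat, by omega⟩
    have h1 : (-(-((k : ℤ) + 1))).toNat = k + 1 := by omega
    have h2 : (-(-((k : ℤ) + 1) + 1)).toNat = k := by omega
    rw [if_pos (by omega), if_pos (by omega), if_pos (by omega), h1, h2, Nat.choose_succ_succ']
    push_cast
    ring
  · simp
  · rw [if_neg (by omega), if_neg (by omega), if_neg (by omega), add_zero]

theorem exists_zmod_addMonoidHom_injective {p n : ℕ} (hp : p ∣ n) (hn : n ≠ 0) :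
    ∃ f : ZMod p →+ ZMod n, Function.Injective f := by
  obtain ⟨d, rfl⟩ := hp
  have hd : (d : ℤ) ≠ 0 := by rintro h; simp_all
  let g : ℤ →+ ZMod (p * d) := (Int.castAddHom _).comp (AddMonoidHom.mulRight (d : ℤ))
  refine ⟨ZMod.lift p ⟨g, ?_⟩, (ZMod.lift_injective _).2 fun x hx => ?_⟩
  · simpa [g] using (by exact_mod_cast ZMod.natCast_self (p * d) :
      ((p : ZMod (p * d)) * (d : ZMod (p * d))) = 0)
  · have hx' : ((x * d : ℤ) : ZMod (p * d)) = 0 := hx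
    rw [ZMod.intCast_zmod_eq_zero_iff_dvd, Nat.cast_mul] at hx'
    exact (ZMod.intCast_zmod_eq_zero_iff_dvd _ _).2 (Int.dvd_of_mul_dvd_mul_right hd hx')

/-- Outside the primes in `P`, the partial products stabilise. -/
theorem exists_coprime_part {S : ℕ → ℕ} (hS : ∀ k, 2 ≤ S k) {n K : ℕ}
    (hK : ∀ k, K < k → ∀ q : ℕ, q.Prime → q ∣ S k → q ∣ n) :
    ∃ m, m.Coprime n ∧ m ∣ odProd S K ∧ ∀ k, ∃ j, odProd S k ∣ m * n ^ j := by
  obtain ⟨m, r, j, hmr, hm, hr⟩ := exists_coprime_mul_dvd_pow n (odProd_pos hS K).ne'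
  refine ⟨m, hm, ⟨r, hmr⟩, fun k => ?_⟩
  rcases le_total k K with hk | hk
  · exact ⟨j, (odProd_dvd_of_le S hk).trans (hmr ▸ mul_dvd_mul_left m hr)⟩
  induction k, hk using Nat.le_induction with
  | base => exact ⟨j, hmr ▸ mul_dvd_mul_left m hr⟩
  | succ k hk ih =>
    obtain ⟨j, hj⟩ := ih
    obtain ⟨m', r', j', hs, hm', hr'⟩ :=
      exists_coprime_mul_dvd_pow n (N := S (k + 1)) (by have := hS (k + 1); omega)
    have hm1 : m' = 1 := by
      by_contra hne
      obtain ⟨q, hq, hqm⟩ := Nat.exists_prime_and_dvd hne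
      exact Nat.not_coprime_of_dvd_of_dvd hq.one_lt hqm
        (hK (k + 1) (by omega) q hq (hs ▸ hqm.mul_right r')) hm'
    have h : odProd S (k + 1) = odProd S k * S (k + 1) := Finset.prod_range_succ S (k + 1)
    refine ⟨j + j', ?_⟩
    rw [h, hs, hm1, one_mul, pow_add, ← mul_assoc]
    exact mul_dvd_mul hj hr'

/-- A finite window of positive coordinates suffices to separate a periodic orbit. -/
theorem exists_finite_window {X : Type*} {m : ℕ} (hm : 0 < m) {y : ℕ → ℤ → X}
    (hper : ∀ a b, a ≡ b [MOD m] → y a = y b)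
    (hsep : ∀ a b, (∀ i, 0 < i → y a i = y b i) → a ≡ b [MOD m]) :
    ∃ W : Finset ℤ, (∀ i ∈ W, 0 < i) ∧ ∀ a b, (∀ i ∈ W, y a i = y b i) → a ≡ b [MOD m] := by
  have hex : ∀ x : ℕ × ℕ, ∃ i : ℤ, 0 < i ∧ (y x.1 i = y x.2 i → x.1 ≡ x.2 [MOD m]) := by
    intro x
    by_cases h : x.1 ≡ x.2 [MOD m]
    · exact ⟨1, one_pos, fun _ => h⟩
    · obtain ⟨i, hi, hne⟩ : ∃ i, 0 < i ∧ y x.1 i ≠ y x.2 i := by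
        by_contra! hc
        exact h (hsep _ _ hc)
      exact ⟨i, hi, fun h => absurd h hne⟩
  choose w hw0 hw using hex
  refine ⟨(Finset.range m ×ˢ Finset.range m).image w, ?_, fun a b h => ?_⟩
  · intro i hi
    obtain ⟨x, -, rfl⟩ := Finset.mem_image.1 hi
    exact hw0 x
  · have h' := h (w (a % m, b % m)) (Finset.mem_image_of_mem _ (by
      simp [Nat.mod_lt _ hm]))
    rw [← hper _ _ (Nat.mod_modEq a m), ← hper _ _ (Nat.mod_modEq b m)] at h'
    exact ((Nat.mod_modEq a m).symm.trans (hw (a % m, b % m) h')).trans (Nat.mod_modEq b m)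

/-- A finitary odometer — one such that the set of prime divisors of the
members of `S` is finite — can be embedded in `((ℤ/nℤ)^ℤ, T_n)`, where `n` is
the product of the primes that divide infinitely many members of `S`. -/
theorem finitary_odometer_embeds (S : ℕ → ℕ) (hS : ∀ k, 2 ≤ S k)
    (hfin : {p : ℕ | p.Prime ∧ ∃ k, p ∣ S k}.Finite)
    (P : Finset ℕ) (hP : ∀ p : ℕ, p ∈ P ↔ p.Prime ∧ {k : ℕ | p ∣ S k}.Infinite)
    (n : ℕ) (hn : n = ∏ p ∈ P, p) :
    ∃ Y : Set (ℤ → ZMod n), IsClosed Y ∧ Set.MapsTo (Tca n) Y Y ∧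
      ∃ h : OdometerSpace S ≃ₜ Y,
        ∀ z, (h (odometerAddOne S z) : ℤ → ZMod n) = Tca n (h z) := by
  have hprime : ∀ p ∈ P, p.Prime := fun p hp => ((hP p).1 hp).1
  have hdvd : ∀ p ∈ P, p ∣ n := fun p hp => hn ▸ Finset.dvd_prod_of_mem _ hp
  have hn0 : n ≠ 0 := hn ▸ Finset.prod_ne_zero_iff.2 fun p hp => (hprime p hp).ne_zero
  obtain ⟨K, hK⟩ : ∃ K, ∀ k, K < k → ∀ q : ℕ, q.Prime → q ∣ S k → q ∈ P := by
    have hbad : (⋃ q ∈ {q : ℕ | q.Prime ∧ ∃ k, q ∣ S k} \ P, {k : ℕ | q ∣ S k}).Finite := by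
      refine (hfin.subset Set.sdiff_subset).biUnion fun q hq => ?_
      by_contra hinf
      exact hq.2 ((hP q).2 ⟨hq.1.1, hinf⟩)
    obtain ⟨K, hK⟩ := hbad.bddAbove
    refine ⟨K, fun k hk q hq hqk => ?_⟩
    by_contra hqP
    exact hk.not_ge (hK (Set.mem_biUnion (x := q) ⟨⟨hq, k, hqk⟩, hqP⟩ hqk))
  obtain ⟨p, hp⟩ : ∃ p, p ∈ P := by
    have h2 := hS (K + 1)
    exact ⟨_, hK (K + 1) (by omega) _ (Nat.minFac_prime (by omega)) (Nat.minFac_dvd _)⟩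
  have : Fact p.Prime := ⟨hprime p hp⟩
  obtain ⟨m, hmn, hmK, hm⟩ :=
    exists_coprime_part hS fun k hk q hq hqk => hdvd q (hK k hk q hq hqk)
  have hm0 : 0 < m := Nat.pos_of_dvd_of_pos hmK (odProd_pos hS K)
  obtain ⟨y, hy, hyper, hysep⟩ := exists_periodic_orbit p (hmn.coprime_dvd_right (hdvd p hp))
  obtain ⟨f, hf⟩ := exists_zmod_addMonoidHom_injective (hdvd p hp) hn0
  obtain ⟨W, hW0, hW⟩ := exists_finite_window hm0 hyper hysep
  refine OdometerSpace.exists_embedding_of_orbit hS (fun a i => f (y a i) + pascalOrbit n a i)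
    (fun a => ?_) (fun i => ?_) (fun k => ?_)
  · ext i
    rw [← hy a, ← Tca_pascalOrbit]
    simp only [Tca, map_add]
    ring
  · have hpow : ∀ q : P, ∃ k, (q : ℕ) ^ (-i).toNat ∣ odProd S k := fun q =>
      exists_pow_dvd_odProd ((hP q).1 q.2).2 _
    choose κ hκ using hpow
    let L := max K (P.attach.sup κ)
    have hnL : n ^ (-i).toNat ∣ odProd S L := hn ▸ prod_pow_dvd hprime fun q hq =>
      (hκ ⟨q, hq⟩).trans (odProd_dvd_of_le S
        ((Finset.le_sup (Finset.mem_attach P ⟨q, hq⟩)).trans (le_max_right _ _)))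
    refine ⟨L, fun a b hab => ?_⟩
    have hab' := hab.of_dvd (hmK.trans (odProd_dvd_of_le S (le_max_left _ _)))
    simp only [hyper a b hab', pascalOrbit, cast_choose_eq_of_modEq (hab.of_dvd hnL)]
  · obtain ⟨j, hj⟩ := hm k
    refine ⟨W ∪ Finset.Icc (-(n ^ j : ℕ) : ℤ) 0, fun a b hab => Nat.ModEq.of_dvd hj ?_⟩
    have habm : a ≡ b [MOD m] := hW a b fun i hi => hf (by
      have hi0 := hW0 i hi
      simpa [pascalOrbit, hi0.not_ge] using hab i (Finset.mem_union_left _ hi))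
    have hchoose : ∀ i ≤ n ^ j, a.choose i ≡ b.choose i [MOD n] := fun i hi => by
      have h := hab (-(i : ℤ)) (Finset.mem_union_right _ (Finset.mem_Icc.2 ⟨by omega, by omega⟩))
      rw [hyper a b habm] at h
      simpa [pascalOrbit, ZMod.natCast_eq_natCast_iff] using h
    refine (Nat.modEq_and_modEq_iff_modEq_mul (hmn.pow_right j)).1 ⟨habm, ?_⟩
    rw [Nat.modEq_iff_dvd, Int.natCast_dvd, hn]
    refine prod_pow_dvd hprime fun q hq => ?_
    have : Fact q.Prime := ⟨hprime q hq⟩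
    rw [← Int.natCast_dvd, ← Nat.modEq_iff_dvd]
    exact modEq_pow_of_choose_modEq j fun i hi => (hchoose i
      (hi.trans (Nat.pow_le_pow_left (Nat.le_of_dvd hn0.bot_lt (hdvd q hq)) j))).of_dvd (hdvd q hq)
end

section
/- Let n ≥ 2, let x ∈ (ℤ/nℤ)^ℤ, and suppose that column i of the space-time diagram of T_n with seed x is periodic with least period m. Then column i−1 is periodic, and its least period equals m·n' for some positive divisor n' of n. -/
/-- Column `i` of the space-time diagram of `T_n` with seed `x`:
`j ↦ [T_n^j(x)]_i`. -/
def col (n : ℕ) (x : ℤ → ZMod n) (i : ℤ) : ℕ → ZMod n := fun j => (Tca n)^[j] x i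

/-- A sequence `f : ℕ → α` is periodic with least period `m`. -/
def HasLeastPeriod {α : Type*} (f : ℕ → α) (m : ℕ) : Prop :=
  0 < m ∧ (∀ j, f (j + m) = f j) ∧ ∀ m', 0 < m' → (∀ j, f (j + m') = f j) → m ≤ m'

theorem HasLeastPeriod.dvd {α : Type*} {f : ℕ → α} {m k : ℕ} (h : HasLeastPeriod f m)
    (hk : ∀ j, f (j + k) = f j) : m ∣ k := by
  obtain ⟨hm, hper, hmin⟩ := h
  by_contra hdvd
  have hpos : 0 < k % m := Nat.pos_of_ne_zero fun h0 => hdvd (Nat.dvd_of_mod_eq_zero h0)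
  refine absurd (hmin (k % m) hpos fun j => ?_) (not_le.2 (Nat.mod_lt k hm))
  have hmul := (show Function.Periodic f m from hper).nsmul (k / m) (j + k % m)
  rw [← hmul, ← hk j, smul_eq_mul, add_assoc, mul_comm, Nat.mod_add_div]

theorem col_succ (n : ℕ) (x : ℤ → ZMod n) (i : ℤ) (j : ℕ) :
    col n x i (j + 1) = col n x i j + col n x (i + 1) j := by
  simp only [col, Function.iterate_succ_apply']
  rfl

/-- If the differences of `g` have least period `m`, then the least period of `g` is `m` times the
additive order of `g m - g 0`, provided that order is finite. -/
theorem HasLeastPeriod.of_diff {A : Type*} [AddCommGroup A] {f g : ℕ → A} {m : ℕ}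
    (hg : ∀ j, g (j + 1) = g j + f j) (h : HasLeastPeriod f m)
    (hpos : 0 < addOrderOf (g m - g 0)) :
    HasLeastPeriod g (m * addOrderOf (g m - g 0)) := by
  have shift : ∀ j, g (j + m) = g j + (g m - g 0) := by
    intro j
    induction j with
    | zero => simp
    | succ j ih => rw [add_right_comm, hg, hg, ih, h.2.1]; abel
  have shift_mul : ∀ q j, g (j + m * q) = g j + q • (g m - g 0) := by
    intro q
    induction q with
    | zero => simp
    | succ q ih => intro j; rw [mul_add_one, ← add_assoc, shift, ih, succ_nsmul, add_assoc]
  refine ⟨Nat.mul_pos h.1 hpos, fun j => ?_, fun k hk hper => ?_⟩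
  · rw [shift_mul, addOrderOf_nsmul_eq_zero, add_zero]
  · have hf : ∀ j, f (j + k) = f j := fun j => by
      have := hper (j + 1)
      rw [add_right_comm, hg, hg, hper j] at this
      exact add_left_cancel this
    obtain ⟨q, rfl⟩ := h.dvd hf
    have hq : q • (g m - g 0) = 0 := by
      have := hper 0
      rwa [shift_mul, add_eq_left] at this
    exact Nat.le_of_dvd hk (mul_dvd_mul_left m (addOrderOf_dvd_of_nsmul_eq_zero hq))

/-- If column `i` of the space-time diagram of `T_n` with seed `x` is periodic
with least period `m`, then column `i - 1` is periodic with least period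
`m * n'` for some positive divisor `n'` of `n`. -/
theorem column_left_least_period (n : ℕ) (hn : 2 ≤ n) (x : ℤ → ZMod n) (i : ℤ)
    (m : ℕ) (h : HasLeastPeriod (col n x i) m) :
    ∃ n' : ℕ, n' ∣ n ∧ 0 < n' ∧ HasLeastPeriod (col n x (i - 1)) (m * n') := by
  have hdvd : addOrderOf (col n x (i - 1) m - col n x (i - 1) 0) ∣ n :=
    addOrderOf_dvd_of_nsmul_eq_zero (by simp)
  have hpos := Nat.pos_of_dvd_of_pos hdvd (by lia)
  refine ⟨_, hdvd, hpos, h.of_diff (fun j => ?_) hpos⟩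
  rw [col_succ, sub_add_cancel]
end

section
/- Let p be prime. There exists a strictly increasing sequence of positive integers k_1 = 1 < k_2 < k_3 < ⋯ such that for every i ≥ 1 and every column index c with −k_{i+1}+1 ≤ c ≤ −k_i, column c of the space-time diagram of T_p with seed x̄ is periodic with least period p^i. -/
/-- The point `x̄` with `x̄_0 = 1` and `x̄_i = 0` for `i ≠ 0`. -/
def xbar (n : ℕ) : ℤ → ZMod n := fun i => if i = 0 then 1 else 0

/-- The space-time diagram of `x̄` consists of binomial coefficients:
`[T_n^j(x̄)]_i` is `0` for `i > 0` and `j.choose m` for `i = -m`. -/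
theorem Tca_iterate_xbar (n j : ℕ) :
    (∀ i : ℤ, 0 < i → (Tca n)^[j] (xbar n) i = 0) ∧
      ∀ m : ℕ, (Tca n)^[j] (xbar n) (-(m : ℤ)) = (j.choose m : ZMod n) := by
  induction j with
  | zero =>
    refine ⟨fun i hi => by simp [xbar, hi.ne'], fun m => ?_⟩
    cases m with
    | zero => simp [xbar]
    | succ m =>
      have : -((m + 1 : ℕ) : ℤ) ≠ 0 := by omega
      rw [Function.iterate_zero_apply, xbar, if_neg this]
      simp
  | succ j ih =>
    obtain ⟨hpos, hneg⟩ := ih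
    rw [Function.iterate_succ_apply']
    refine ⟨fun i hi => ?_, fun m => ?_⟩
    · simp only [Tca]
      rw [hpos i hi, hpos (i + 1) (by omega), add_zero]
    · simp only [Tca]
      rw [hneg m]
      cases m with
      | zero => rw [hpos _ (by simp)]; simp
      | succ m =>
        have : -((m + 1 : ℕ) : ℤ) + 1 = -(m : ℤ) := by push_cast; ring
        rw [this, hneg m, Nat.choose_succ_succ, Nat.cast_add, add_comm]

theorem col_xbar_neg (n m j : ℕ) : col n (xbar n) (-(m : ℤ)) j = (j.choose m : ZMod n) :=
  (Tca_iterate_xbar n j).2 m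

theorem choose_add_prime_pow_cast {p : ℕ} (hp : p.Prime) {i m : ℕ} (hm : m < p ^ i) (j : ℕ) :
    ((j + p ^ i).choose m : ZMod p) = (j.choose m : ZMod p) := by
  rw [Nat.add_choose_eq, Nat.cast_sum, Finset.sum_eq_single (m, 0)]
  · simp
  · rintro ⟨a, b⟩ hab hne
    rw [Finset.HasAntidiagonal.mem_antidiagonal] at hab
    have hb : b ≠ 0 := by
      rintro rfl
      exact hne (by simpa using hab)
    have hbi : b ≠ p ^ i := by
      simp only at hab
      omega
    rw [Nat.cast_mul, (ZMod.natCast_eq_zero_iff _ _).2 (hp.dvd_choose_pow hb hbi), mul_zero]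
  · simp

/-- The natural-number periods of a sequence are closed under `gcd`. -/
theorem periodic_gcd {α : Type*} {f : ℕ → α} {a b : ℕ} (ha : ∀ j, f (j + a) = f j)
    (hb : ∀ j, f (j + b) = f j) (j : ℕ) : f (j + a.gcd b) = f j := by
  let shift : (ℕ → α) → ℕ → α := fun g j => g (j + 1)
  have iter (n : ℕ) (g : ℕ → α) (j : ℕ) : shift^[n] g j = g (j + n) := by
    induction n generalizing g with
    | zero => rfl
    | succ n ih =>
      rw [Function.iterate_succ_apply, ih]
      simp only [shift, add_assoc]
  have hA : Function.IsPeriodicPt shift a f := funext fun j => (iter a f j).trans (ha j)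
  have hB : Function.IsPeriodicPt shift b f := funext fun j => (iter b f j).trans (hb j)
  exact (iter _ f j).symm.trans (congrFun (hA.gcd hB) j)

/-- A period of `j ↦ j.choose m` modulo `n > 1` exceeds `m`. -/
theorem lt_of_choose_periodic {n m d : ℕ} (hn : 1 < n) (hd : 0 < d)
    (h : ∀ j, ((j + d).choose m : ZMod n) = (j.choose m : ZMod n)) : m < d := by
  by_contra! hdm
  have : Fact (1 < n) := ⟨hn⟩
  have key := h (m - d)
  rw [Nat.sub_add_cancel hdm, Nat.choose_self, Nat.choose_eq_zero_of_lt (by omega)] at key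
  simp at key

theorem choose_hasLeastPeriod {p : ℕ} (hp : p.Prime) {i m : ℕ} (hlo : p ^ i ≤ m)
    (hhi : m < p ^ (i + 1)) :
    HasLeastPeriod (fun j : ℕ => (j.choose m : ZMod p)) (p ^ (i + 1)) := by
  have hper := choose_add_prime_pow_cast hp hhi
  refine ⟨pow_pos hp.pos _, hper, fun d hd hdper => ?_⟩
  obtain ⟨s, -, hs⟩ := (Nat.dvd_prime_pow hp).1 (Nat.gcd_dvd_right d (p ^ (i + 1)))
  have hlt : m < p ^ s := by
    rw [← hs]
    exact lt_of_choose_periodic hp.one_lt (Nat.gcd_pos_of_pos_left _ hd)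
      (periodic_gcd (f := fun j : ℕ => (j.choose m : ZMod p)) hdper hper)
  have his : i < s := (Nat.pow_lt_pow_iff_right hp.one_lt).1 (hlo.trans_lt hlt)
  calc p ^ (i + 1) ≤ p ^ s := Nat.pow_le_pow_right hp.pos his
    _ = d.gcd (p ^ (i + 1)) := hs.symm
    _ ≤ d := Nat.gcd_le_left _ hd

/-- For `p` prime, there exist `1 = k₁ < k₂ < ⋯` such that for every `i ≥ 1`,
the columns `c` with `-k_{i+1} + 1 ≤ c ≤ -k_i` of the space-time diagram of
`T_p` with seed `x̄` are periodic with least period `p^i`. -/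
theorem xbar_column_periods (p : ℕ) (hp : p.Prime) :
    ∃ k : ℕ → ℕ, k 1 = 1 ∧ (∀ i, 1 ≤ i → k i < k (i + 1)) ∧
      ∀ i, 1 ≤ i → ∀ c : ℤ, -(k (i + 1) : ℤ) + 1 ≤ c → c ≤ -(k i : ℤ) →
        HasLeastPeriod (col p (xbar p) c) (p ^ i) := by
  refine ⟨fun i => p ^ (i - 1), by simp, fun i hi => ?_, fun i hi c hc₁ hc₂ => ?_⟩
  · exact Nat.pow_lt_pow_right hp.one_lt (by omega)
  · obtain ⟨i, rfl⟩ := Nat.exists_eq_add_of_le' hi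
    simp only [Nat.add_sub_cancel] at hc₁ hc₂
    obtain ⟨m, rfl⟩ : ∃ m : ℕ, c = -(m : ℤ) := ⟨(-c).toNat, by omega⟩
    rw [funext (col_xbar_neg p m)]
    exact choose_hasLeastPeriod hp (by omega) (by omega)
end

section
/- For p prime, the p-adic odometer (ℤ_p, z ↦ z + 1), where ℤ_p is the ring of p-adic integers with its usual compact topology, can be embedded in the two-sided cellular automaton ((ℤ/pℤ)^ℤ, T_p). -/
section PadicOdometer

variable {p : ℕ} [Fact p.Prime]

lemma PadicInt.continuous_toZMod :
    Continuous (PadicInt.toZMod : ℤ_[p] → ZMod p) := by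
  refine (IsLocallyConstant.iff_eventually_eq _).2 (fun x => ?_) |>.continuous
  filter_upwards [Metric.ball_mem_nhds x one_pos] with y hy
  rw [← sub_eq_zero, ← map_sub, ← RingHom.mem_ker, PadicInt.ker_toZMod,
    IsLocalRing.mem_maximalIdeal, PadicInt.mem_nonunits, ← dist_eq_norm]
  exact hy

/-- The sequence of binomial coefficients `choose z k` modulo `p`, with `choose z k` at
position `-k` and zeros at positive positions. -/
noncomputable def binomialSeq (z : ℤ_[p]) (i : ℤ) : ZMod p :=
  if i ≤ 0 then PadicInt.toZMod (Ring.choose z i.natAbs) else 0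

lemma binomialSeq_neg_natCast (z : ℤ_[p]) (k : ℕ) :
    binomialSeq z (-k) = PadicInt.toZMod (Ring.choose z k) := by
  simp [binomialSeq]

lemma binomialSeq_of_pos (z : ℤ_[p]) {i : ℤ} (hi : 0 < i) : binomialSeq z i = 0 :=
  if_neg hi.not_ge

lemma continuous_binomialSeq : Continuous (binomialSeq (p := p)) := by
  refine continuous_pi fun i => ?_
  unfold binomialSeq
  split_ifs
  · exact PadicInt.continuous_toZMod.comp (PadicInt.continuous_choose _)
  · exact continuous_const

lemma binomialSeq_add_one (z : ℤ_[p]) : binomialSeq (z + 1) = Tca p (binomialSeq z) := by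
  funext i
  unfold Tca
  rcases lt_or_ge 0 i with hi | hi
  · simp [binomialSeq_of_pos, hi, hi.trans (lt_add_one i)]
  obtain ⟨k, rfl⟩ : ∃ k : ℕ, i = -k := ⟨i.natAbs, by omega⟩
  cases k with
  | zero => simp [binomialSeq]
  | succ k =>
    rw [show -((k + 1 : ℕ) : ℤ) + 1 = -(k : ℤ) by push_cast; ring]
    simp only [binomialSeq_neg_natCast, Ring.choose_succ_succ, map_add]
    exact add_comm _ _

lemma binomialSeq_add_right {z w : ℤ_[p]} (h : binomialSeq z = binomialSeq w) (u : ℤ_[p]) :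
    binomialSeq (z + u) = binomialSeq (w + u) := by
  refine congrFun (PadicInt.denseRange_natCast.equalizer
    (continuous_binomialSeq.comp (continuous_const_add z))
    (continuous_binomialSeq.comp (continuous_const_add w)) (funext fun n => ?_)) u
  induction n with
  | zero => simpa using h
  | succ n ih =>
    simp only [Function.comp_apply] at ih
    simp only [Function.comp_apply, Nat.cast_succ, ← add_assoc, binomialSeq_add_one, ih]

lemma binomialSeq_mul_left {d : ℤ_[p]} (h : binomialSeq d = binomialSeq 0) (u : ℤ_[p]) :
    binomialSeq (u * d) = binomialSeq 0 := by
  refine congrFun (PadicInt.denseRange_natCast.equalizer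
    (continuous_binomialSeq.comp (continuous_mul_const d))
    (continuous_const (y := binomialSeq 0)) (funext fun n => ?_)) u
  induction n with
  | zero => simp
  | succ n ih =>
    simp only [Function.comp_apply] at ih
    simp only [Function.comp_apply, Nat.cast_succ, add_one_mul, add_comm _ d]
    rw [binomialSeq_add_right h, zero_add, ih]

lemma binomialSeq_natCast_ne {n : ℕ} (hn : 0 < n) :
    binomialSeq (n : ℤ_[p]) ≠ binomialSeq 0 := fun h => by
  have := congrFun h (-n)
  simp [binomialSeq_neg_natCast, Ring.choose_natCast, Ring.choose_zero_pos _ hn] at this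

lemma binomialSeq_injective : Function.Injective (binomialSeq (p := p)) := by
  intro z w h
  by_contra hne
  have hd : z - w ≠ 0 := sub_ne_zero.2 hne
  have h0 : binomialSeq (z - w) = binomialSeq 0 := by
    simpa [sub_eq_add_neg] using binomialSeq_add_right h (-w)
  have hdp : ↑(PadicInt.unitCoeff hd)⁻¹ * (z - w) = (p : ℤ_[p]) ^ (z - w).valuation :=
    (Units.inv_mul_eq_iff_eq_mul _).2 (PadicInt.unitCoeff_spec hd)
  have hp := binomialSeq_mul_left h0 ↑(PadicInt.unitCoeff hd)⁻¹
  refine binomialSeq_natCast_ne (p := p) (pow_pos (Fact.out : p.Prime).pos (z - w).valuation) ?_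
  rw [← hp, hdp, Nat.cast_pow]

end PadicOdometer

/-- For `p` prime, the `p`-adic odometer `(ℤ_p, z ↦ z + 1)` can be embedded in
the two-sided cellular automaton `((ℤ/pℤ)^ℤ, T_p)`. -/
theorem padic_odometer_embeds (p : ℕ) [Fact p.Prime] :
    ∃ Y : Set (ℤ → ZMod p), IsClosed Y ∧ Set.MapsTo (Tca p) Y Y ∧
      ∃ h : ℤ_[p] ≃ₜ Y, ∀ z : ℤ_[p], (h (z + 1) : ℤ → ZMod p) = Tca p (h z) := by
  have hc := (continuous_binomialSeq (p := p)).isClosedEmbedding binomialSeq_injective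
  refine ⟨Set.range binomialSeq, hc.isClosed_range, ?_,
    hc.isEmbedding.toHomeomorph, fun z => binomialSeq_add_one z⟩
  rintro _ ⟨z, rfl⟩
  exact ⟨z + 1, binomialSeq_add_one z⟩
end

section
/- Let p be prime. The map Φ : (ℤ/pℤ)^{ℕ_0} → (ℤ/pℤ)^{ℕ_0} defined by [Φ(x)]_i = [(T_p)_R^i(x)]_0 (i ≥ 0) is a homeomorphism satisfying Φ ∘ (T_p)_R = σ_L ∘ Φ; hence the one-sided cellular automaton ((ℤ/pℤ)^{ℕ_0}, (T_p)_R) is topologically conjugate to the full one-sided shift ((ℤ/pℤ)^{ℕ_0}, σ_L). -/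
/-- The one-sided cellular automaton `(T_n)_R` on `(ℤ/nℤ)^{ℕ₀}` with local rule
`xᵢ ↦ xᵢ + xᵢ₊₁ (mod n)`. -/
def TR (n : ℕ) (x : ℕ → ZMod n) : ℕ → ZMod n := fun i => x i + x (i + 1)

/-- The left shift `σ_L` on `(ℤ/nℤ)^{ℕ₀}`. -/
def shiftL (n : ℕ) (x : ℕ → ZMod n) : ℕ → ZMod n := fun i => x (i + 1)

/-- The map `Φ` with `[Φ(x)]_i = [(T_p)_R^i(x)]_0`. -/
def Phi (p : ℕ) (x : ℕ → ZMod p) : ℕ → ZMod p := fun i => (TR p)^[i] x 0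

/-- The forward difference operator on sequences in `ℤ/nℤ`. -/
def forwardDiff (n : ℕ) (y : ℕ → ZMod n) : ℕ → ZMod n := fun i => y (i + 1) - y i

/-- The inverse of `Phi`: the sequence of iterated forward differences at `0`. -/
def PhiInv (n : ℕ) (y : ℕ → ZMod n) : ℕ → ZMod n := fun i => (forwardDiff n)^[i] y 0

theorem iterate_shiftL_apply (n i j : ℕ) (x : ℕ → ZMod n) :
    (shiftL n)^[i] x j = x (j + i) := by
  induction i generalizing x with
  | zero => rfl
  | succ i ih => rw [Function.iterate_succ_apply, ih]; rfl

theorem Phi_semiconj_shiftL (n : ℕ) :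
    Function.Semiconj (Phi n) (shiftL n) (forwardDiff n) := by
  intro x
  funext i
  have hcomm : Function.Commute (TR n) (shiftL n) := fun _ => rfl
  have h : (TR n)^[i] (shiftL n x) 0 = (TR n)^[i] x 1 :=
    congrFun (hcomm.iterate_left i x) 0
  simp only [Phi, forwardDiff, h, Function.iterate_succ_apply']
  simp [TR]

theorem PhiInv_semiconj_shiftL (n : ℕ) :
    Function.Semiconj (PhiInv n) (shiftL n) (TR n) := by
  intro y
  funext i
  have hcomm : Function.Commute (forwardDiff n) (shiftL n) := fun _ => rfl
  have h : (forwardDiff n)^[i] (shiftL n y) 0 = (forwardDiff n)^[i] y 1 :=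
    congrFun (hcomm.iterate_left i y) 0
  simp only [PhiInv, TR, h, Function.iterate_succ_apply']
  simp [forwardDiff]

theorem PhiInv_leftInverse (n : ℕ) : Function.LeftInverse (PhiInv n) (Phi n) := by
  intro x
  funext i
  have h := congrFun ((Phi_semiconj_shiftL n).iterate_right i x) 0
  calc (forwardDiff n)^[i] (Phi n x) 0 = (shiftL n)^[i] x 0 := h.symm
    _ = x i := by rw [iterate_shiftL_apply, zero_add]

theorem PhiInv_rightInverse (n : ℕ) : Function.RightInverse (PhiInv n) (Phi n) := by
  intro y
  funext i
  have h := congrFun ((PhiInv_semiconj_shiftL n).iterate_right i y) 0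
  calc (TR n)^[i] (PhiInv n y) 0 = (shiftL n)^[i] y 0 := h.symm
    _ = y i := by rw [iterate_shiftL_apply, zero_add]

theorem continuous_TR (n : ℕ) : Continuous (TR n) :=
  continuous_pi fun i => (continuous_apply i).add (continuous_apply (i + 1))

theorem continuous_forwardDiff (n : ℕ) : Continuous (forwardDiff n) :=
  continuous_pi fun i => (continuous_apply (i + 1)).sub (continuous_apply i)

theorem continuous_Phi (n : ℕ) : Continuous (Phi n) :=
  continuous_pi fun i => (continuous_apply 0).comp ((continuous_TR n).iterate i)

theorem continuous_PhiInv (n : ℕ) : Continuous (PhiInv n) :=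
  continuous_pi fun i => (continuous_apply 0).comp ((continuous_forwardDiff n).iterate i)

/-- For `p` prime, `Φ` is a homeomorphism with `Φ ∘ (T_p)_R = σ_L ∘ Φ`; hence
`((ℤ/pℤ)^{ℕ₀}, (T_p)_R)` is topologically conjugate to the full one-sided
shift `((ℤ/pℤ)^{ℕ₀}, σ_L)`. -/
theorem TR_conjugate_to_shift (p : ℕ) (hp : p.Prime) :
    IsHomeomorph (Phi p) ∧ Phi p ∘ TR p = shiftL p ∘ Phi p := by
  refine ⟨?_, rfl⟩
  let e : (ℕ → ZMod p) ≃ₜ (ℕ → ZMod p) :=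
    { toFun := Phi p
      invFun := PhiInv p
      left_inv := PhiInv_leftInverse p
      right_inv := PhiInv_rightInverse p
      continuous_toFun := continuous_Phi p
      continuous_invFun := continuous_PhiInv p }
  exact e.isHomeomorph
end

section
/- Let p be prime and m ≥ 1. There exists a point ȳ ∈ (ℤ/pℤ)^ℤ such that ȳ has an infinite forward T_p-orbit (the iterates T_p^j(ȳ), j ≥ 0, are pairwise distinct) and the right half ȳ_R = (ȳ_0, ȳ_1, ȳ_2, …) ∈ (ℤ/pℤ)^{ℕ_0} is (T_p)_R-periodic with least period m, i.e. m is the smallest positive integer with (T_p)_R^m(ȳ_R) = ȳ_R. -/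
theorem Tca_iterate_apply_of_eq_zero {n : ℕ} (x : ℤ → ZMod n) (b : ℕ) (i : ℤ)
    (h : ∀ k : ℕ, k < b → x (i + k) = 0) : (Tca n)^[b] x i = x (i + b) := by
  induction b generalizing x with
  | zero => simp
  | succ b ih =>
    rw [Function.iterate_succ_apply, ih]
    · have := h b (by omega)
      simp only [Tca, this, zero_add]
      push_cast
      ring_nf
    · intro k hk
      have h₁ := h k (by omega)
      have h₂ := h (k + 1) (by omega)
      push_cast at h₂
      simp only [Tca, h₁, zero_add, add_assoc, h₂]

/-- The left-hand markers at the positions `-2 ^ n` are separated by arbitrarily long gaps of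
zeros, which forces an infinite orbit. -/
theorem injective_Tca_iterate_of_sparse {n : ℕ} (hn : (1 : ZMod n) ≠ 0) (x : ℤ → ZMod n)
    (h₁ : ∀ k : ℕ, x (-2 ^ k) = 1)
    (h₀ : ∀ i : ℤ, i < 0 → (∀ k : ℕ, i ≠ -2 ^ k) → x i = 0) :
    Function.Injective (fun j : ℕ => (Tca n)^[j] x) := by
  refine Function.Injective.of_lt_imp_ne fun a b hab heq => hn ?_
  have gap : ∀ k : ℕ, k < b → x (-2 ^ b - b + k) = 0 := by
    intro k hk
    have hb : (b : ℤ) < 2 ^ b := by exact_mod_cast Nat.lt_two_pow_self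
    refine h₀ _ (by omega) fun l hl => ?_
    have lo : (2 : ℤ) ^ b < 2 ^ l := by omega
    have hi : (2 : ℤ) ^ l < 2 ^ (b + 1) := by rw [pow_succ]; omega
    have lo' := (pow_lt_pow_iff_right₀ (by norm_num : (1 : ℤ) < 2)).1 lo
    have hi' := (pow_lt_pow_iff_right₀ (by norm_num : (1 : ℤ) < 2)).1 hi
    omega
  have hA := Tca_iterate_apply_of_eq_zero x a (-2 ^ b - b) fun k hk => gap k (by omega)
  have hB := Tca_iterate_apply_of_eq_zero x b (-2 ^ b - b) gap
  rw [gap a hab] at hA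
  rw [sub_add_cancel, h₁] at hB
  rw [← hA, ← hB]
  exact (congrFun heq _).symm

theorem TR_iterate_fwdDiff {n : ℕ} (c : ℕ → ZMod n) (j : ℕ) :
    (TR n)^[j] (fun i => (fwdDiff 1)^[i] c 0) = fun i => (fwdDiff 1)^[i] c j := by
  induction j with
  | zero => rfl
  | succ j ih =>
    rw [Function.iterate_succ_apply', ih]
    funext i
    simp only [TR, Function.iterate_succ_apply', fwdDiff]
    ring

theorem Function.Periodic.fwdDiff_iterate {M G : Type*} [AddCommMonoid M] [AddCommGroup G]
    {c : M → G} {m : M} (hc : Function.Periodic c m) (h : M) (i : ℕ) :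
    Function.Periodic ((fwdDiff h)^[i] c) m := by
  induction i with
  | zero => exact hc
  | succ i ih =>
    intro j
    simp only [Function.iterate_succ_apply', fwdDiff]
    rw [add_right_comm, ih, ih]

/-- For `p` prime and `m ≥ 1` there is a point `ȳ ∈ (ℤ/pℤ)^ℤ` with an infinite
forward `T_p`-orbit whose right half `ȳ_R = (ȳ_0, ȳ_1, …)` is `(T_p)_R`-periodic
with least period `m`. -/
theorem exists_point_infinite_orbit_periodic_right (p : ℕ) (hp : p.Prime)
    (m : ℕ) (hm : 1 ≤ m) :
    ∃ y : ℤ → ZMod p,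
      Function.Injective (fun j : ℕ => (Tca p)^[j] y) ∧
      (TR p)^[m] (fun i : ℕ => y (i : ℤ)) = (fun i : ℕ => y (i : ℤ)) ∧
      ∀ m' : ℕ, 0 < m' →
        (TR p)^[m'] (fun i : ℕ => y (i : ℤ)) = (fun i : ℕ => y (i : ℤ)) →
        m ≤ m' := by
  have : Fact p.Prime := ⟨hp⟩
  classical
  let c : ℕ → ZMod p := fun j => if m ∣ j then 1 else 0
  have hc : Function.Periodic c m := fun j => by simp [c]
  let y : ℤ → ZMod p := fun k =>
    if 0 ≤ k then (fwdDiff 1)^[k.toNat] c 0 else if ∃ l : ℕ, k = -2 ^ l then 1 else 0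
  have hy : (fun i : ℕ => y i) = fun i => (fwdDiff 1)^[i] c 0 := by
    funext i
    simp [y]
  refine ⟨y, injective_Tca_iterate_of_sparse one_ne_zero y ?_ ?_, ?_, ?_⟩
  · intro k
    have : ¬ (0 : ℤ) ≤ -2 ^ k := by
      have : (0 : ℤ) < 2 ^ k := by positivity
      omega
    simp only [y, if_neg this]
    exact if_pos ⟨k, rfl⟩
  · intro i hi h
    simp only [y, if_neg hi.not_ge]
    exact if_neg fun ⟨l, hl⟩ => h l hl
  · rw [hy, TR_iterate_fwdDiff]
    funext i
    simpa using hc.fwdDiff_iterate 1 i 0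
  · intro m' hm' h
    rw [hy, TR_iterate_fwdDiff] at h
    have h0 : c m' = c 0 := congrFun h 0
    refine Nat.le_of_dvd hm' ?_
    by_contra hd
    simp [c, hd] at h0
end
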